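/- arXiv:1112.3380 — 7 statements merged into one kernel-verified Lean document; each statement's English description precedes it below -/
import Mathlib

section
/- For every real t ≥ 0, σ_γ(t) ≤ 2 + γ·√t. (Part (19) of Proposition 6: the right edge of the diffusively growing stack of rectangles is bounded by 2 + γ√t.) -/
/-- **Proposition 6, part (19).**  Fix `γ > 1`.  With `d k = 2(⌊γ^k/2⌋ + 1)`,
`t k = ∑_{i<k} (d i)²`, and `σ` the right edge of the stack of rectangles
(`σ t = d k` whenever `t k ≤ t < t (k+1)`), one has `σ t ≤ 2 + γ √t` for all `t ≥ 0`. -/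
theorem stmt_0 (γ : ℝ) (hγ : 1 < γ)
    (d : ℕ → ℝ) (hd : ∀ k : ℕ, d k = 2 * (⌊γ ^ k / 2⌋ + 1))
    (t : ℕ → ℝ) (ht : ∀ k : ℕ, t k = ∑ i ∈ Finset.range k, (d i) ^ 2)
    (σ : ℝ → ℝ) (hσ : ∀ (s : ℝ) (k : ℕ), t k ≤ s → s < t (k + 1) → σ s = d k) :
    ∀ s : ℝ, 0 ≤ s → σ s ≤ 2 + γ * Real.sqrt s := by
  intro s hs
  have hlow : ∀ k, γ ^ k ≤ d k := by
    intro k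
    have := Int.lt_floor_add_one (γ ^ k / 2)
    rw [hd k]; linarith
  have hup : ∀ k, d k ≤ γ ^ k + 2 := by
    intro k
    have := Int.floor_le (γ ^ k / 2)
    rw [hd k]; linarith
  have hsucc : ∀ k, t (k + 1) = t k + d k ^ 2 := by
    intro k
    rw [ht, ht, Finset.sum_range_succ]
  have h0 : t 0 = 0 := by rw [ht]; simp
  have hone : ∀ k, 1 ≤ d k := fun k => (one_le_pow₀ hγ.le).trans (hlow k)
  have htn : ∀ n : ℕ, (n : ℝ) ≤ t n := by
    intro n
    induction n with
    | zero => simp [h0]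
    | succ n ih =>
      rw [hsucc]; push_cast
      nlinarith [hone n]
  have hex : ∃ n, s < t n := by
    obtain ⟨n, hn⟩ := exists_nat_gt s
    exact ⟨n, hn.trans_le (htn n)⟩
  classical
  obtain ⟨k, hk1, hk2⟩ : ∃ k, t k ≤ s ∧ s < t (k + 1) := by
    have hspec := Nat.find_spec hex
    have hmin := fun m => Nat.find_min hex (m := m)
    cases hN : Nat.find hex with
    | zero => rw [hN, h0] at hspec; linarith
    | succ k => exact ⟨k, not_lt.mp (hmin k (by omega)), hN ▸ hspec⟩
  rw [hσ s k hk1 hk2]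
  cases k with
  | zero =>
    have hd0 : d 0 = 2 := by
      have : ⌊(1 : ℝ) / 2⌋ = 0 := by norm_num
      rw [hd, pow_zero, this]; norm_num
    rw [hd0]
    have : 0 ≤ γ * Real.sqrt s := by positivity
    linarith
  | succ j =>
    have h1 : d j ≤ Real.sqrt s := by
      apply Real.le_sqrt_of_sq_le
      have h2 := htn j
      have h3 : (0 : ℝ) ≤ j := Nat.cast_nonneg j
      rw [hsucc] at hk1
      linarith
    have h4 : γ * γ ^ j ≤ γ * Real.sqrt s :=
      mul_le_mul_of_nonneg_left ((hlow j).trans h1) (by linarith)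
    have h5 := hup (j + 1)
    rw [pow_succ] at h5
    linarith
end

section
/- limsup_{t → ∞} σ_γ(t)/√t ≤ √(γ² − 1). (Part (20) of Proposition 6.) -/
/-- **Proposition 6, part (20).**  Fix `γ > 1`.  With `d k = 2(⌊γ^k/2⌋ + 1)`,
`t k = ∑_{i<k} (d i)²`, and `σ` the right edge of the stack of rectangles
(`σ t = d k` whenever `t k ≤ t < t (k+1)`), one has
`limsup_{t → ∞} σ(t)/√t ≤ √(γ² − 1)`. -/
theorem stmt_1 (γ : ℝ) (hγ : 1 < γ)
    (d : ℕ → ℝ) (hd : ∀ k : ℕ, d k = 2 * (⌊γ ^ k / 2⌋ + 1))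
    (t : ℕ → ℝ) (ht : ∀ k : ℕ, t k = ∑ i ∈ Finset.range k, (d i) ^ 2)
    (σ : ℝ → ℝ) (hσ : ∀ (s : ℝ) (k : ℕ), t k ≤ s → s < t (k + 1) → σ s = d k) :
    Filter.limsup (fun s : ℝ => σ s / Real.sqrt s) Filter.atTop
      ≤ Real.sqrt (γ ^ 2 - 1) := by
  have hdl : ∀ k, γ ^ k ≤ d k := by
    intro k
    have := Int.lt_floor_add_one (γ ^ k / 2)
    rw [hd]; linarith
  have hdu : ∀ k, d k ≤ γ ^ k + 2 := by
    intro k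
    have := Int.floor_le (γ ^ k / 2)
    rw [hd]; linarith
  have hg1 : ∀ k : ℕ, 1 ≤ γ ^ k := fun k => one_le_pow₀ hγ.le
  have htsucc : ∀ k, t (k + 1) = t k + d k ^ 2 := by
    intro k
    rw [ht, ht, Finset.sum_range_succ]
  have ht0 : t 0 = 0 := by simp [ht]
  have htk : ∀ k : ℕ, (k : ℝ) ≤ t k := by
    intro k
    induction k with
    | zero => simp [ht0]
    | succ k ih =>
      rw [htsucc]
      push_cast
      nlinarith [hdl k, hg1 k]
  have hc : 0 < γ ^ 2 - 1 := by nlinarith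
  have htg : ∀ k : ℕ, (γ ^ k) ^ 2 - 1 ≤ (γ ^ 2 - 1) * t k := by
    intro k
    induction k with
    | zero => simp [ht0]
    | succ k ih =>
      rw [htsucc]
      have h1 : (γ ^ k) ^ 2 ≤ d k ^ 2 := by
        have := hg1 k
        exact pow_le_pow_left₀ (by linarith) (hdl k) 2
      have h2 := mul_le_mul_of_nonneg_left h1 hc.le
      have h3 : (γ ^ (k + 1)) ^ 2 = γ ^ 2 * (γ ^ k) ^ 2 := by ring
      rw [h3]
      linarith
  have key : ∀ s : ℝ, 0 ≤ s → 0 ≤ σ s ∧ σ s ≤ Real.sqrt (γ ^ 2 - 1) * Real.sqrt s + 3 := by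
    intro s hs
    have hex : ∃ k, s < t k := by
      obtain ⟨k, hk⟩ := exists_nat_gt s
      exact ⟨k, hk.trans_le (htk k)⟩
    classical
    obtain ⟨k, hk1, hk2⟩ : ∃ k, t k ≤ s ∧ s < t (k + 1) := by
      have h := Nat.find_spec hex
      have hm := fun m => @Nat.find_min _ _ hex m
      rcases hn : Nat.find hex with _ | n
      · rw [hn, ht0] at h; linarith
      · rw [hn] at h
        exact ⟨n, not_lt.mp (hm n (by omega)), h⟩
    rw [hσ s k hk1 hk2]
    refine ⟨by linarith [hdl k, hg1 k], ?_⟩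
    have h1 := htg k
    have h2 := mul_le_mul_of_nonneg_left hk1 hc.le
    have h3 : γ ^ k ≤ Real.sqrt (γ ^ 2 - 1) * Real.sqrt s + 1 := by
      have hp : 0 ≤ Real.sqrt (γ ^ 2 - 1) * Real.sqrt s := by positivity
      refine le_trans (le_abs_self _) (abs_le_of_sq_le_sq ?_ (by linarith))
      have h4 : (Real.sqrt (γ ^ 2 - 1) * Real.sqrt s) ^ 2 = (γ ^ 2 - 1) * s := by
        rw [mul_pow, Real.sq_sqrt hc.le, Real.sq_sqrt hs]
      nlinarith
    linarith [hdu k]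
  have hlim : Filter.Tendsto (fun s : ℝ => Real.sqrt (γ ^ 2 - 1) + 3 / Real.sqrt s)
      Filter.atTop (nhds (Real.sqrt (γ ^ 2 - 1))) := by
    have := (Real.tendsto_sqrt_atTop.const_div_atTop 3).const_add (Real.sqrt (γ ^ 2 - 1))
    simpa using this
  rw [← hlim.limsup_eq]
  refine Filter.limsup_le_limsup ?_ ?_ hlim.isBoundedUnder_le
  · filter_upwards [Filter.eventually_gt_atTop 0] with s hs
    have hq := Real.sqrt_pos.mpr hs
    rw [div_le_iff₀ hq, add_mul, div_mul_cancel₀ _ hq.ne']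
    exact (key s hs.le).2
  · refine Filter.IsBoundedUnder.isCoboundedUnder_le ⟨0, ?_⟩
    rw [Filter.eventually_map]
    filter_upwards [Filter.eventually_gt_atTop 0] with s hs
    exact div_nonneg (key s hs.le).1 (Real.sqrt_nonneg s)
end

section
/- For every integer k ≥ 1 and every real t with t ≥ t_k, d_k ≤ √((γ² − 1)/(1 − γ^{−2k}))·√t + 2. -/
/-- Fix `γ > 1`.  With `d k = 2(⌊γ^k/2⌋ + 1)` and `t k = ∑_{i<k} (d i)²`:
for every `k ≥ 1` and every real `s ≥ t k`,
`d k ≤ √((γ² − 1)/(1 − γ^{−2k})) · √s + 2`. -/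
theorem stmt_3 (γ : ℝ) (hγ : 1 < γ)
    (d : ℕ → ℝ) (hd : ∀ k : ℕ, d k = 2 * (⌊γ ^ k / 2⌋ + 1))
    (t : ℕ → ℝ) (ht : ∀ k : ℕ, t k = ∑ i ∈ Finset.range k, (d i) ^ 2) :
    ∀ k : ℕ, 1 ≤ k → ∀ s : ℝ, t k ≤ s →
      d k ≤ Real.sqrt ((γ ^ 2 - 1) / (1 - γ ^ (-(2 * (k : ℤ))))) * Real.sqrt s + 2 := by
  intro k hk s hs
  have h0 : (0:ℝ) < γ := by linarith
  have hdi : ∀ i, γ ^ i ≤ d i := by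
    intro i
    rw [hd]
    have := Int.lt_floor_add_one (γ ^ i / 2)
    linarith
  have hg : (γ ^ 2 - 1) * ∑ i ∈ Finset.range k, (γ ^ 2) ^ i = (γ ^ 2) ^ k - 1 := by
    rw [mul_comm]
    exact geom_sum_mul (γ ^ 2) k
  have hsum : ∑ i ∈ Finset.range k, (γ ^ 2) ^ i ≤ s := by
    refine le_trans (Finset.sum_le_sum fun i _ => ?_) ((ht k).symm.le.trans hs)
    rw [← pow_mul, mul_comm, pow_mul]
    exact pow_le_pow_left₀ (by positivity) (hdi i) 2
  have h2 : 1 < γ ^ 2 := one_lt_pow₀ hγ (by norm_num)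
  have hx : 1 < (γ ^ 2) ^ k := one_lt_pow₀ h2 (by omega)
  have hz : γ ^ (-(2 * (k : ℤ))) = ((γ ^ 2) ^ k)⁻¹ := by
    rw [zpow_neg, ← pow_mul]
    norm_cast
  have hxk : (γ ^ 2) ^ k = (γ ^ k) ^ 2 := by rw [← pow_mul, ← pow_mul, mul_comm]
  have hinv : ((γ ^ 2) ^ k)⁻¹ < 1 := inv_lt_one_of_one_lt₀ hx
  have hsx : (γ ^ 2) ^ k - 1 ≤ (γ ^ 2 - 1) * s := by
    rw [← hg]
    exact mul_le_mul_of_nonneg_left hsum (by linarith)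
  have key : γ ^ k ≤ Real.sqrt ((γ ^ 2 - 1) / (1 - γ ^ (-(2 * (k : ℤ))))) * Real.sqrt s := by
    rw [hz, ← Real.sqrt_mul (div_nonneg (by linarith) (by linarith))]
    apply Real.le_sqrt_of_sq_le
    rw [← hxk, div_mul_eq_mul_div, le_div_iff₀ (by linarith), mul_sub,
      mul_inv_cancel₀ (by linarith), mul_one]
    exact hsx
  have := Int.floor_le (γ ^ k / 2)
  rw [hd]
  linarith
end

section
/- For every real C with 0 < C < α·√(γ² − 1)/γ there exists an integer k₀ such that for all k ≥ k₀, w_k ≥ C·√(t_{k+1}·log(t_{k+1})). (This is the claim of Section 5 that the widths w_k of the superdiffusive rectangles eventually dominate C√(t log t) at the top of each rectangle.) -/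
/-- Fix `γ > 1` and `α > 0`.  With `d k = 2(⌊γ^k/2⌋ + 1)`, `t k = ∑_{i<k} (d i)²`
and `w k = 2(⌊α √(log(d k²) · d k²)/2⌋ + 1)`:  for every real `C` with
`0 < C < α √(γ² − 1)/γ` there is `k₀` such that `w k ≥ C √(t (k+1) · log (t (k+1)))`
for all `k ≥ k₀`. -/
theorem stmt_4 (γ α : ℝ) (hγ : 1 < γ) (hα : 0 < α)
    (d : ℕ → ℝ) (hd : ∀ k : ℕ, d k = 2 * (⌊γ ^ k / 2⌋ + 1))
    (t : ℕ → ℝ) (ht : ∀ k : ℕ, t k = ∑ i ∈ Finset.range k, (d i) ^ 2)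
    (w : ℕ → ℝ)
    (hw : ∀ k : ℕ, w k = 2 * (⌊α * Real.sqrt (Real.log ((d k) ^ 2) * (d k) ^ 2) / 2⌋ + 1)) :
    ∀ C : ℝ, 0 < C → C < α * Real.sqrt (γ ^ 2 - 1) / γ →
      ∃ k₀ : ℕ, ∀ k : ℕ, k₀ ≤ k →
        C * Real.sqrt (t (k + 1) * Real.log (t (k + 1))) ≤ w k := by
  intro C hC hCa
  have hg0 : 0 < γ := by linarith
  have hg1 : 0 < γ - 1 := by linarith
  have hg2 : 0 < γ ^ 2 - 1 := by nlinarith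
  have hlog : 0 < Real.log γ := Real.log_pos hγ
  have hdl : ∀ k, γ ^ k ≤ d k := by
    intro k
    rw [hd]
    have := Int.lt_floor_add_one (γ ^ k / 2)
    linarith
  have hdu : ∀ k, d k ≤ γ ^ k + 2 := by
    intro k
    rw [hd]
    have := Int.floor_le (γ ^ k / 2)
    linarith
  have htb : ∀ n : ℕ, t n ≤ γ ^ (2 * n) / (γ ^ 2 - 1) + 4 * γ ^ n / (γ - 1) + 4 * n := by
    intro n
    rw [ht]
    induction n with
    | zero => simp; positivity
    | succ n ih =>
      rw [Finset.sum_range_succ]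
      have h1 : d n ^ 2 ≤ (γ ^ n + 2) ^ 2 := by
        have h0 : 0 < γ ^ n := by positivity
        have := hdl n
        exact pow_le_pow_left₀ (by linarith) (hdu n) 2
      have h2 : γ ^ (2 * (n + 1)) / (γ ^ 2 - 1) + 4 * γ ^ (n + 1) / (γ - 1) + 4 * ((n + 1 : ℕ) : ℝ)
          = γ ^ (2 * n) / (γ ^ 2 - 1) + 4 * γ ^ n / (γ - 1) + 4 * n + (γ ^ n + 2) ^ 2 := by
        push_cast
        field_simp
        ring
      rw [h2]
      linarith
  have ht1 : ∀ k : ℕ, 1 ≤ t (k + 1) := by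
    intro k
    rw [ht, Finset.sum_range_succ]
    have h0 : 0 ≤ ∑ i ∈ Finset.range k, d i ^ 2 := Finset.sum_nonneg fun i _ => sq_nonneg _
    have h1 : 1 ≤ γ ^ k := one_le_pow₀ hγ.le
    have := hdl k
    nlinarith
  set F : ℕ → ℝ := fun k => γ ^ 2 / (γ ^ 2 - 1) + 4 * γ / (γ - 1) * (γ⁻¹) ^ k
    + 4 * (k * ((γ ^ 2)⁻¹) ^ k + ((γ ^ 2)⁻¹) ^ k) with hF
  have hFt : ∀ k, t (k + 1) ≤ F k * γ ^ (2 * k) := by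
    intro k
    refine (htb (k + 1)).trans (le_of_eq ?_)
    simp only [hF]
    push_cast
    have e1 : γ⁻¹ ^ k * γ ^ (2 * k) = γ ^ k := by
      rw [inv_pow, two_mul, pow_add]; field_simp
    have e2 : (γ ^ 2)⁻¹ ^ k * γ ^ (2 * k) = 1 := by
      rw [inv_pow, ← pow_mul]; field_simp
    linear_combination (-(4 * γ / (γ - 1))) * e1 - 4 * (k + 1) * e2
  have hFlim : Filter.Tendsto F Filter.atTop (nhds (γ ^ 2 / (γ ^ 2 - 1))) := by
    have r1 : γ⁻¹ < 1 := inv_lt_one_of_one_lt₀ hγ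
    have r2 : (γ ^ 2)⁻¹ < 1 := inv_lt_one_of_one_lt₀ (by linarith)
    have l1 := tendsto_pow_atTop_nhds_zero_of_lt_one (by positivity) r1
    have l2 := tendsto_pow_atTop_nhds_zero_of_lt_one (by positivity) r2
    have l3 := tendsto_self_mul_const_pow_of_lt_one (by positivity) r2
    have := ((l1.const_mul (4 * γ / (γ - 1))).const_add (γ ^ 2 / (γ ^ 2 - 1))).add
      ((l3.add l2).const_mul 4)
    simpa [hF] using this
  have hLpos : 0 < γ ^ 2 / (γ ^ 2 - 1) := by positivity
  have hHlim : Filter.Tendsto (fun k : ℕ => C ^ 2 * F k *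
      (1 + Real.log (F k) / (2 * Real.log γ) * (1 / (k : ℝ)))) Filter.atTop
      (nhds (C ^ 2 * (γ ^ 2 / (γ ^ 2 - 1)))) := by
    have l4 := (((hFlim.log hLpos.ne').div_const (2 * Real.log γ)).mul
      tendsto_one_div_atTop_nhds_zero_nat).const_add 1
    have := (hFlim.const_mul (C ^ 2)).mul l4
    simpa using this
  have hCL : C ^ 2 * (γ ^ 2 / (γ ^ 2 - 1)) < α ^ 2 := by
    have h1 : C ^ 2 < (α * Real.sqrt (γ ^ 2 - 1) / γ) ^ 2 := pow_lt_pow_left₀ hCa hC.le two_ne_zero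
    rw [div_pow, mul_pow, Real.sq_sqrt hg2.le, lt_div_iff₀ (by positivity)] at h1
    rw [← mul_div_assoc, div_lt_iff₀ hg2]
    exact h1
  obtain ⟨k₀, hk₀⟩ := Filter.eventually_atTop.1
    ((hHlim.eventually_lt_const hCL).and (Filter.eventually_ge_atTop 1))
  refine ⟨k₀, fun k hk => ?_⟩
  obtain ⟨hH, hk1⟩ := hk₀ k hk
  have hkpos : (0 : ℝ) < k := by exact_mod_cast hk1
  have hP : 0 < γ ^ (2 * k) := by positivity
  have htk := ht1 k
  have hFpos : 0 < F k := by
    by_contra h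
    have := hFt k
    nlinarith
  have hlt : Real.log (t (k + 1)) ≤ Real.log (F k) + 2 * k * Real.log γ := by
    have := Real.log_le_log (by linarith) (hFt k)
    rw [Real.log_mul hFpos.ne' hP.ne', Real.log_pow] at this
    push_cast at this
    exact this
  have hlt0 : 0 ≤ Real.log (t (k + 1)) := Real.log_nonneg htk
  have hd2 : γ ^ (2 * k) ≤ d k ^ 2 := by
    rw [mul_comm, pow_mul]
    exact pow_le_pow_left₀ (by positivity) (hdl k) 2
  have hld : 2 * k * Real.log γ ≤ Real.log (d k ^ 2) := by
    have := Real.log_le_log hP hd2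
    rw [Real.log_pow] at this
    push_cast at this
    exact this
  have hld0 : 0 ≤ Real.log (d k ^ 2) := le_trans (by positivity) hld
  have hm : t (k + 1) * Real.log (t (k + 1)) ≤
      (F k * γ ^ (2 * k)) * (Real.log (F k) + 2 * k * Real.log γ) :=
    mul_le_mul (hFt k) hlt hlt0 (by positivity)
  have key : C ^ 2 * (t (k + 1) * Real.log (t (k + 1))) ≤
      α ^ 2 * (Real.log (d k ^ 2) * d k ^ 2) := by
    calc C ^ 2 * (t (k + 1) * Real.log (t (k + 1)))
        ≤ C ^ 2 * ((F k * γ ^ (2 * k)) * (Real.log (F k) + 2 * k * Real.log γ)) := by gcongr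
      _ = (C ^ 2 * F k * (1 + Real.log (F k) / (2 * Real.log γ) * (1 / (k : ℝ)))) *
          ((2 * k * Real.log γ) * γ ^ (2 * k)) := by
        field_simp
        ring
      _ ≤ α ^ 2 * ((2 * k * Real.log γ) * γ ^ (2 * k)) := by gcongr
      _ ≤ α ^ 2 * (Real.log (d k ^ 2) * d k ^ 2) := by gcongr
  have hsq := Real.sqrt_le_sqrt key
  rw [Real.sqrt_mul (sq_nonneg C), Real.sqrt_mul (sq_nonneg α), Real.sqrt_sq hC.le,
    Real.sqrt_sq hα.le] at hsq
  rw [hw]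
  have := Int.lt_floor_add_one (α * Real.sqrt (Real.log ((d k) ^ 2) * (d k) ^ 2) / 2)
  linarith
end

section
/- There exists a real constant C (depending only on γ and α) with the following property: for every function f : ℕ → ℝ, if there exists an integer k₀ such that for all k ≥ k₀ one has max_{t_k ≤ n ≤ t_{k+1}} (f(n) − f(t_k)) ≤ w_k, then limsup_{n → ∞} f(n)/√(n·log n) ≤ C. (This is the deterministic step (24) in the proof of Theorem 3: if the block events Υ_k fail for all large k, the path is at most C-superdiffusive.) -/
/-- **Deterministic step (24) in the proof of Theorem 3.**  Fix `γ > 1`, `α > 0`.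
With `d k = 2(⌊γ^k/2⌋ + 1)`, `t k = ∑_{i<k} (d i)²` (natural numbers) and
`w k = 2(⌊α √(log(d k²) · d k²)/2⌋ + 1)`:  there is a constant `C` (depending only
on `γ` and `α`) such that for every `f : ℕ → ℝ`, if for all large `k` one has
`f n − f (t k) ≤ w k` for all `t k ≤ n ≤ t (k+1)`, then
`limsup_{n → ∞} f n / √(n log n) ≤ C`. -/
theorem stmt_5 (γ α : ℝ) (hγ : 1 < γ) (hα : 0 < α)
    (d : ℕ → ℕ) (hd : ∀ k : ℕ, (d k : ℤ) = 2 * (⌊γ ^ k / 2⌋ + 1))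
    (t : ℕ → ℕ) (ht : ∀ k : ℕ, t k = ∑ i ∈ Finset.range k, (d i) ^ 2)
    (w : ℕ → ℝ)
    (hw : ∀ k : ℕ, w k = 2 * (⌊α * Real.sqrt (Real.log ((d k : ℝ) ^ 2) * (d k : ℝ) ^ 2) / 2⌋ + 1)) :
    ∃ C : ℝ, ∀ f : ℕ → ℝ,
      (∃ k₀ : ℕ, ∀ k : ℕ, k₀ ≤ k →
        ∀ n : ℕ, t k ≤ n → n ≤ t (k + 1) → f n - f (t k) ≤ w k) →
      Filter.limsup (fun n : ℕ => f n / Real.sqrt (n * Real.log n)) Filter.atTop ≤ C := by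
  have hγ0 : 0 < γ := by linarith
  have hpow1 : ∀ k : ℕ, 1 ≤ γ ^ k := fun k => one_le_pow₀ hγ.le
  have hdr : ∀ k : ℕ, (d k : ℝ) = 2 * ((⌊γ ^ k / 2⌋ : ℝ) + 1) := by
    intro k
    have h := hd k
    have h2 : ((d k : ℤ) : ℝ) = ((2 * (⌊γ ^ k / 2⌋ + 1) : ℤ) : ℝ) := by rw [h]
    push_cast at h2
    exact h2
  have hdlow : ∀ k, γ ^ k ≤ d k := by
    intro k
    have := Int.lt_floor_add_one (γ ^ k / 2)
    rw [hdr]; linarith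
  have hdup : ∀ k, (d k : ℝ) ≤ 3 * γ ^ k := by
    intro k
    have := Int.floor_le (γ ^ k / 2)
    have := hpow1 k
    rw [hdr]; linarith
  have hd2 : ∀ k, (2 : ℝ) ≤ d k := by
    intro k
    have h : (0 : ℤ) ≤ ⌊γ ^ k / 2⌋ := Int.floor_nonneg.2 (by have := hpow1 k; positivity)
    have h' : (0 : ℝ) ≤ (⌊γ ^ k / 2⌋ : ℝ) := by exact_mod_cast h
    rw [hdr]; linarith
  have hdmono : ∀ j k, j ≤ k → (d j : ℝ) ≤ d k := by
    intro j k hjk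
    have h1 : γ ^ j / 2 ≤ γ ^ k / 2 := by
      have := pow_le_pow_right₀ hγ.le hjk
      linarith
    have h : (⌊γ ^ j / 2⌋ : ℝ) ≤ (⌊γ ^ k / 2⌋ : ℝ) := by exact_mod_cast Int.floor_le_floor h1
    rw [hdr, hdr]; linarith
  have hL1 : ∀ k, 1 ≤ Real.log ((d k : ℝ) ^ 2) := by
    intro k
    rw [Real.log_pow]
    have h1 : Real.log 2 ≤ Real.log (d k) := Real.log_le_log (by norm_num) (hd2 k)
    have h2 := Real.log_two_gt_d9
    push_cast
    linarith
  have hwle : ∀ j k, j ≤ k → w j ≤ (3 * α + 2) * √(Real.log ((d k : ℝ) ^ 2)) * γ ^ j := by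
    intro j k hjk
    have hdj := hd2 j
    have hfl := Int.floor_le (α * Real.sqrt (Real.log ((d j : ℝ) ^ 2) * (d j : ℝ) ^ 2) / 2)
    have hs : Real.sqrt (Real.log ((d j : ℝ) ^ 2) * (d j : ℝ) ^ 2)
        = √(Real.log ((d j : ℝ) ^ 2)) * d j := by
      rw [Real.sqrt_mul (by linarith [hL1 j]), Real.sqrt_sq (by linarith)]
    have hm : √(Real.log ((d j : ℝ) ^ 2)) ≤ √(Real.log ((d k : ℝ) ^ 2)) := by
      apply Real.sqrt_le_sqrt
      apply Real.log_le_log (by positivity)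
      have := hdmono j k hjk
      gcongr
    have h1 : 1 ≤ √(Real.log ((d k : ℝ) ^ 2)) := Real.one_le_sqrt.2 (hL1 k)
    have h2 : √(Real.log ((d j : ℝ) ^ 2)) * d j ≤ √(Real.log ((d k : ℝ) ^ 2)) * (3 * γ ^ j) :=
      mul_le_mul hm (hdup j) (by linarith) (by linarith)
    have h3 : α * (√(Real.log ((d j : ℝ) ^ 2)) * d j)
        ≤ α * (√(Real.log ((d k : ℝ) ^ 2)) * (3 * γ ^ j)) := mul_le_mul_of_nonneg_left h2 hα.le
    have h4 : 1 ≤ √(Real.log ((d k : ℝ) ^ 2)) * γ ^ j := one_le_mul_of_one_le_of_one_le h1 (hpow1 j)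
    rw [hw j]
    rw [hs] at hfl ⊢
    linarith
  have htS : ∀ k, t (k + 1) = t k + (d k) ^ 2 := by
    intro k
    rw [ht, ht, Finset.sum_range_succ]
  have hdN : ∀ k, 1 ≤ d k := by
    intro k
    have h := hd2 k
    have : (1 : ℝ) ≤ d k := by linarith
    exact_mod_cast this
  have htmono : StrictMono t := by
    apply strictMono_nat_of_lt_succ
    intro k
    have := htS k
    have : 0 < (d k) ^ 2 := pow_pos (hdN k) 2
    omega
  set B : ℝ := (3 * α + 2) * (γ ^ 2 / (γ - 1)) * √2 with hB
  have hγ1 : 0 < γ - 1 := by linarith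
  have hB0 : 0 ≤ B := by positivity
  refine ⟨B + 1, ?_⟩
  rintro f ⟨k₀, hf⟩
  have hchain : ∀ k, k₀ ≤ k → f (t k) ≤ f (t k₀) + ∑ j ∈ Finset.Ico k₀ k, w j := by
    intro k hk
    induction k, hk using Nat.le_induction with
    | base => simp
    | succ k hk ih =>
      rw [Finset.sum_Ico_succ_top hk]
      have := hf k hk (t (k + 1)) (htmono.monotone (Nat.le_succ k)) le_rfl
      linarith
  have hev : ∀ᶠ n : ℕ in Filter.atTop, f n / Real.sqrt (n * Real.log n) ≤ B + 1 := by
    have hlim : Filter.Tendsto (fun n : ℕ => Real.sqrt ((n : ℝ) * Real.log n))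
        Filter.atTop Filter.atTop := by
      apply Real.tendsto_sqrt_atTop.comp
      exact tendsto_natCast_atTop_atTop.atTop_mul_atTop₀
        (Real.tendsto_log_atTop.comp tendsto_natCast_atTop_atTop)
    filter_upwards [hlim.eventually_ge_atTop (f (t k₀)), hlim.eventually_ge_atTop 1,
      Filter.eventually_ge_atTop (t (k₀ + 1)),
      (tendsto_natCast_atTop_atTop (R := ℝ)).eventually_ge_atTop (9 * γ ^ 2)] with n h1 h2 h3 h4
    rw [div_le_iff₀ (by linarith)]
    have hex : ∃ m, n < t m := ⟨n + 1, lt_of_lt_of_le (Nat.lt_succ_self n) (htmono.le_apply)⟩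
    obtain ⟨k, hk, hk1, hk2⟩ : ∃ k, k₀ ≤ k ∧ t (k + 1) ≤ n ∧ n < t (k + 2) := by
      have hs := Nat.find_spec hex
      have hmin := fun m => Nat.find_min hex (m := m)
      generalize Nat.find hex = m at hs hmin
      have hm : k₀ + 1 < m := htmono.lt_iff_lt.1 (lt_of_le_of_lt h3 hs)
      obtain ⟨k, rfl⟩ : ∃ k, m = k + 2 := ⟨m - 2, by omega⟩
      exact ⟨k, by omega, not_lt.1 (hmin (k + 1) (by omega)), hs⟩
    have hc := hchain (k + 1) (by omega)
    have hl := hf (k + 1) (by omega) n hk1 hk2.le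
    have hsum : f n ≤ f (t k₀) + ∑ j ∈ Finset.Ico k₀ (k + 2), w j := by
      rw [Finset.sum_Ico_succ_top (by omega)]
      linarith
    set S := √(Real.log ((d (k + 1) : ℝ) ^ 2)) with hS
    have hS0 : 0 ≤ S := Real.sqrt_nonneg _
    have hsum2 : ∑ j ∈ Finset.Ico k₀ (k + 2), w j ≤ (3 * α + 2) * S * (γ ^ (k + 2) / (γ - 1)) := by
      calc ∑ j ∈ Finset.Ico k₀ (k + 2), w j
          ≤ ∑ j ∈ Finset.Ico k₀ (k + 2), (3 * α + 2) * S * γ ^ j := by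
            apply Finset.sum_le_sum
            intro j hj
            rw [Finset.mem_Ico] at hj
            exact hwle j (k + 1) (by omega)
        _ ≤ ∑ j ∈ Finset.range (k + 2), (3 * α + 2) * S * γ ^ j := by
            apply Finset.sum_le_sum_of_subset_of_nonneg
            · intro j hj
              rw [Finset.mem_Ico] at hj
              exact Finset.mem_range.2 hj.2
            · intro j _ _
              positivity
        _ = (3 * α + 2) * S * ((γ ^ (k + 2) - 1) / (γ - 1)) := by
            rw [← Finset.mul_sum, geom_sum_eq hγ.ne']
        _ ≤ _ := by
            gcongr
            linarith
    have hn : (γ ^ k) ^ 2 ≤ (n : ℝ) := by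
      have e1 : (d k) ^ 2 ≤ n := by
        have := htS k
        omega
      have e2 : (d k : ℝ) ^ 2 ≤ n := by exact_mod_cast e1
      have := hdlow k
      have : (γ ^ k) ^ 2 ≤ (d k : ℝ) ^ 2 := by gcongr
      linarith
    have hγ2 : 0 < γ ^ 2 := by positivity
    have hn0 : (0 : ℝ) < n := by linarith
    have hγn : γ ^ k ≤ √(n : ℝ) := Real.le_sqrt_of_sq_le hn
    have hS2 : S ≤ √2 * √(Real.log n) := by
      rw [← Real.sqrt_mul (by norm_num)]
      apply Real.sqrt_le_sqrt
      have e : (d (k + 1) : ℝ) ^ 2 ≤ (n : ℝ) ^ 2 := by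
        calc (d (k + 1) : ℝ) ^ 2 ≤ (3 * γ ^ (k + 1)) ^ 2 := by
              have := hdup (k + 1)
              gcongr
          _ = (9 * γ ^ 2) * (γ ^ k) ^ 2 := by ring
          _ ≤ n * n := by gcongr
          _ = _ := by ring
      have := Real.log_le_log (by have := hd2 (k + 1); positivity) e
      rw [Real.log_pow (n : ℕ) (n := 2)] at this
      exact_mod_cast this
    have hfin : (3 * α + 2) * S * (γ ^ (k + 2) / (γ - 1)) ≤ B * √((n : ℝ) * Real.log n) := by
      calc (3 * α + 2) * S * (γ ^ (k + 2) / (γ - 1))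
          = (3 * α + 2) * S * (γ ^ 2 * γ ^ k / (γ - 1)) := by ring
        _ ≤ (3 * α + 2) * (√2 * √(Real.log n)) * (γ ^ 2 * √(n : ℝ) / (γ - 1)) := by gcongr
        _ = _ := by
            rw [Real.sqrt_mul hn0.le, hB]
            ring
    linarith
  rw [Filter.limsup_eq]
  by_cases hb : BddBelow {a | ∀ᶠ n : ℕ in Filter.atTop, f n / Real.sqrt (n * Real.log n) ≤ a}
  · exact csInf_le hb hev
  · rw [Real.sInf_of_not_bddBelow hb]
    linarith
end

section
/- Let γ > 1, a > 0, c ≥ 0 and p ∈ (0,1], and set b := log(1/p)/log γ. There exists a finite constant c' (depending only on γ, a, c, p) such that for every s ∈ (0,1], every integer n ≥ 0, and all real sequences (p_k), (q_k) satisfying p ≤ p_k ≤ 1, 0 ≤ q_k ≤ p_k, and q_k ≤ p_k² + c·(γ^k·s)^{−a} for all 0 ≤ k ≤ n, one has ∏_{k=0}^n (q_k/p_k²) ≤ c'·s^{−b}. (This is the analytic core of Lemma 5 (Lemma 4.3 of Fontes–Newman–Ravishankar–Schertzer), applied with p_k = P(C_k), q_k = P(C_k^τ ∩ C_k^{τ'}),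 s = |τ − τ'|.) -/
/-- **Analytic core of Lemma 5 (Lemma 4.3 of FNRS).**  Let `γ > 1`, `a > 0`, `c ≥ 0`,
`p ∈ (0,1]` and `b = log(1/p)/log γ`.  There is a finite constant `c'` such that for
every `s ∈ (0,1]`, every `n`, and all sequences `(p_k)`, `(q_k)` with `p ≤ p_k ≤ 1`,
`0 ≤ q_k ≤ p_k` and `q_k ≤ p_k² + c (γ^k s)^{−a}` for `0 ≤ k ≤ n`, one has
`∏_{k=0}^n q_k / p_k² ≤ c' s^{−b}`. -/
theorem stmt_7 (γ a c p : ℝ) (hγ : 1 < γ) (ha : 0 < a) (hc : 0 ≤ c)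
    (hp0 : 0 < p) (hp1 : p ≤ 1) (b : ℝ) (hb : b = Real.log (1 / p) / Real.log γ) :
    ∃ c' : ℝ, ∀ s : ℝ, 0 < s → s ≤ 1 → ∀ n : ℕ, ∀ pk qk : ℕ → ℝ,
      (∀ k : ℕ, k ≤ n → p ≤ pk k ∧ pk k ≤ 1 ∧ 0 ≤ qk k ∧ qk k ≤ pk k ∧
          qk k ≤ (pk k) ^ 2 + c * (γ ^ k * s) ^ (-a)) →
      ∏ k ∈ Finset.range (n + 1), qk k / (pk k) ^ 2 ≤ c' * s ^ (-b) := by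
  have hlg : 0 < Real.log γ := Real.log_pos hγ
  have hγ0 : 0 < γ := by linarith
  set ρ : ℝ := γ ^ (-a) with hρ
  have hρ0 : 0 < ρ := Real.rpow_pos_of_pos hγ0 _
  have hρ1 : ρ < 1 := Real.rpow_lt_one_of_one_lt_of_neg hγ (by linarith)
  set C : ℝ := c / p ^ 2 with hC
  have hC0 : 0 ≤ C := by positivity
  have hpinv : 1 ≤ p⁻¹ := (one_le_inv₀ hp0).2 hp1
  refine ⟨p⁻¹ * Real.exp (C * (1 - ρ)⁻¹), ?_⟩
  intro s hs0 hs1 n pk qk h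
  set L : ℝ := -Real.log s / Real.log γ with hL
  have hls : Real.log s ≤ 0 := Real.log_nonpos hs0.le hs1
  have hL0 : 0 ≤ L := div_nonneg (by linarith) hlg.le
  obtain ⟨m, hm1, hm2⟩ : ∃ m : ℕ, L ≤ m ∧ (m : ℝ) ≤ L + 1 :=
    ⟨⌈L⌉₊, Nat.le_ceil L, (Nat.ceil_lt_add_one hL0).le⟩
  have hms : 1 ≤ γ ^ m * s := by
    have h1 : 0 ≤ Real.log (γ ^ m * s) := by
      rw [Real.log_mul (by positivity) hs0.ne', Real.log_pow]
      have := (div_le_iff₀ hlg).1 hm1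
      linarith
    exact (Real.log_nonneg_iff (by positivity)).1 h1
  have hpm : (p⁻¹) ^ m ≤ p⁻¹ * s ^ (-b) := by
    have e1 : (p⁻¹) ^ m ≤ (p⁻¹) ^ (L + 1) := by
      rw [← Real.rpow_natCast]
      exact Real.rpow_le_rpow_of_exponent_le hpinv hm2
    have e2 : (p⁻¹) ^ (L + 1) = p⁻¹ * s ^ (-b) := by
      rw [Real.rpow_add (by positivity), Real.rpow_one, mul_comm]
      congr 1
      rw [Real.rpow_def_of_pos (by positivity), Real.rpow_def_of_pos hs0, hb, hL, one_div]
      congr 1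
      ring
    exact e1.trans e2.le
  let f : ℕ → ℝ := fun k => if k < m then p⁻¹ else Real.exp (C * ρ ^ (k - m))
  have hf1 : ∀ k, 1 ≤ f k := by
    intro k
    by_cases hk : k < m
    · simp only [f, hk, if_true]; exact hpinv
    · simp only [f, hk, if_false]
      exact Real.one_le_exp (by positivity)
  have hterm : ∀ k ∈ Finset.range (n + 1), qk k / (pk k) ^ 2 ≤ f k := by
    intro k hk
    obtain ⟨h1, h2, h3, h4, h5⟩ := h k (by simpa [Nat.lt_succ_iff] using hk)
    have hpk : 0 < pk k := by linarith
    by_cases hkm : k < m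
    · simp only [f, hkm, if_true]
      calc qk k / (pk k) ^ 2 ≤ pk k / (pk k) ^ 2 := by gcongr
        _ = (pk k)⁻¹ := by field_simp
        _ ≤ p⁻¹ := by gcongr
    · simp only [f, hkm, if_false]
      have hpw : (γ ^ k * s) ^ (-a) ≤ ρ ^ (k - m) := by
        have e : γ ^ (k - m) ≤ γ ^ k * s := by
          have : γ ^ k = γ ^ (k - m) * γ ^ m := by
            rw [← pow_add, Nat.sub_add_cancel (not_lt.1 hkm)]
          rw [this, mul_assoc]
          exact le_mul_of_one_le_right (by positivity) hms
        calc (γ ^ k * s) ^ (-a) ≤ (γ ^ (k - m)) ^ (-a) :=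
              Real.rpow_le_rpow_of_nonpos (by positivity) e (by linarith)
          _ = ρ ^ (k - m) := by
              rw [hρ, ← Real.rpow_natCast, ← Real.rpow_natCast, ← Real.rpow_mul hγ0.le,
                ← Real.rpow_mul hγ0.le, mul_comm]
      calc qk k / (pk k) ^ 2 ≤ ((pk k) ^ 2 + c * ρ ^ (k - m)) / (pk k) ^ 2 := by
            gcongr
            exact h5.trans (by gcongr)
        _ = c * ρ ^ (k - m) / (pk k) ^ 2 + 1 := by field_simp; ring
        _ ≤ c * ρ ^ (k - m) / p ^ 2 + 1 := by gcongr
        _ = C * ρ ^ (k - m) + 1 := by rw [hC]; ring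
        _ ≤ _ := Real.add_one_le_exp _
  calc ∏ k ∈ Finset.range (n + 1), qk k / (pk k) ^ 2
      ≤ ∏ k ∈ Finset.range (n + 1), f k := by
        refine Finset.prod_le_prod ?_ hterm
        intro k hk
        obtain ⟨h1, h2, h3, h4, h5⟩ := h k (by simpa [Nat.lt_succ_iff] using hk)
        positivity
    _ ≤ ∏ k ∈ Finset.range (m + (n + 1)), f k := by
        rw [add_comm m, Finset.prod_range_add f (n + 1) m]
        refine le_mul_of_one_le_right
          (Finset.prod_nonneg fun k _ => zero_le_one.trans (hf1 k)) ?_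
        calc (1 : ℝ) = ∏ _x ∈ Finset.range m, (1 : ℝ) := by simp
          _ ≤ _ := Finset.prod_le_prod (fun _ _ => zero_le_one) (fun k _ => hf1 _)
    _ = (p⁻¹) ^ m * Real.exp (C * ∑ j ∈ Finset.range (n + 1), ρ ^ j) := by
        rw [Finset.prod_range_add f m (n + 1), Finset.mul_sum, Real.exp_sum]
        congr 1
        · rw [Finset.prod_congr rfl (g := fun _ => p⁻¹)]
          · simp
          · intro k hk
            simp only [f, Finset.mem_range.1 hk, if_true]
        · refine Finset.prod_congr rfl fun j _ => ?_
          simp [f]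
    _ ≤ (p⁻¹ * s ^ (-b)) * Real.exp (C * (1 - ρ)⁻¹) := by
        have hg : ∑ j ∈ Finset.range (n + 1), ρ ^ j ≤ (1 - ρ)⁻¹ := by
          rw [← tsum_geometric_of_lt_one hρ0.le hρ1]
          exact (summable_geometric_of_lt_one hρ0.le hρ1).sum_le_tsum _
            (fun _ _ => by positivity)
        gcongr
    _ = _ := by ring
end

section
/- Let (Ω, ℱ, P) be a probability space, and fix reals γ > 1, a > 0, c > 0. For each integer k ≥ 1 let A_k ⊆ [0,1] × Ω be measurable with respect to the product of the Borel σ-algebra and ℱ, write A_k^τ := {ω : (τ,ω) ∈ A_k}, and suppose there are reals p_k ∈ (0,1] such that: (i) P(A_k^τ) = p_k for all τ ∈ [0,1]; (ii) P(A_k^τ ∩ A_k^{τ'}) ≤ p_k² + c·(γ^k·|τ − τ'|)^{−a} for all τ ≠ τ' in [0,1]; and (iii) p_k·γ^{k/2} → ∞ and p_k²·γ^{ka/2} → ∞ as k → ∞. Then for all 0 ≤ u < v ≤ 1, P({ω : the Lebesgue measure of {τ ∈ [u,v] : (τ,ω) ∈ A_k} is positive}) → 1 as k → ∞. (This is the abstract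 form of Proposition 7 and its proof via the split (i)/(ii) of the second-moment integral, including the strengthening P(Ê_k ∩ [u,v] ≠ ∅) → 1 noted at the end of Section 5.) -/
open MeasureTheory

/-- Second-moment bound for a single jointly measurable set. -/
theorem second_moment_aux {Ω : Type*} [MeasurableSpace Ω] (P : Measure Ω) [IsProbabilityMeasure P]
    (A : Set (ℝ × Ω)) (hA : MeasurableSet A) (p q δ u v : ℝ) (hp : 0 < p) (hq : 0 ≤ q)
    (hδ : 0 ≤ δ) (huv : u < v)
    (h1 : ∀ τ ∈ Set.Icc u v, (P (Prod.mk τ ⁻¹' A)).toReal = p)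
    (h2 : ∀ τ ∈ Set.Icc u v, ∀ τ' ∈ Set.Icc u v, δ < |τ - τ'| →
      (P (Prod.mk τ ⁻¹' A ∩ Prod.mk τ' ⁻¹' A)).toReal ≤ p ^ 2 + q) :
    1 - (2 * δ / ((v - u) * p) + q / p ^ 2) ≤
      (P {ω : Ω | 0 < volume {τ ∈ Set.Icc u v | (τ, ω) ∈ A}}).toReal := by
  set L := v - u with hL
  have hLpos : 0 < L := sub_pos.2 huv
  set μ : Measure ℝ := volume.restrict (Set.Icc u v) with hμ
  have hμuniv : μ Set.univ = ENNReal.ofReal L := by simp [hμ, hL]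
  set f : Ω → ENNReal := fun ω => μ ((fun τ => (τ, ω)) ⁻¹' A) with hf
  have hfm : Measurable f := measurable_measure_prodMk_right hA
  have hfv : ∀ ω, volume {τ ∈ Set.Icc u v | (τ, ω) ∈ A} = f ω := by
    intro ω
    have hm : MeasurableSet ((fun τ => (τ, ω)) ⁻¹' A) := measurable_prodMk_right hA
    simp only [hf, hμ]
    rw [Measure.restrict_apply hm, Set.inter_comm]
    rfl
  have hfle : ∀ ω, f ω ≤ ENNReal.ofReal L := fun ω => hμuniv ▸ measure_mono (Set.subset_univ _)
  have hftop : ∀ ω, f ω ≠ ⊤ := fun ω => ((hfle ω).trans_lt ENNReal.ofReal_lt_top).ne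
  have hsec : ∀ τ ∈ Set.Icc u v, P (Prod.mk τ ⁻¹' A) = ENNReal.ofReal p := by
    intro τ hτ
    rw [← h1 τ hτ, ENNReal.ofReal_toReal (measure_ne_top _ _)]
  have hE1 : ∫⁻ ω, f ω ∂P = ENNReal.ofReal (p * L) := by
    rw [← Measure.prod_apply_symm hA, Measure.prod_apply hA,
      setLIntegral_congr_fun measurableSet_Icc hsec, setLIntegral_const, Real.volume_Icc,
      ENNReal.ofReal_mul hp.le]
  have hE2 : ∫⁻ ω, f ω ^ 2 ∂P ≤ ENNReal.ofReal ((p ^ 2 + q) * L ^ 2 + p * (2 * δ) * L) := by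
    set B : Set ((ℝ × ℝ) × Ω) := {x | (x.1.1, x.2) ∈ A ∧ (x.1.2, x.2) ∈ A} with hB
    have hBm : MeasurableSet B := by
      have e1 : Measurable (fun x : (ℝ × ℝ) × Ω => (x.1.1, x.2)) := by fun_prop
      have e2 : Measurable (fun x : (ℝ × ℝ) × Ω => (x.1.2, x.2)) := by fun_prop
      exact (e1 hA).inter (e2 hA)
    have e : ∀ ω, f ω ^ 2 = (μ.prod μ) ((fun x => (x, ω)) ⁻¹' B) := by
      intro ω
      rw [sq, ← Measure.prod_prod]
      rfl
    have hb : ∀ τ ∈ Set.Icc u v, ∀ τ' ∈ Set.Icc u v, P (Prod.mk (τ, τ') ⁻¹' B) ≤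
        ENNReal.ofReal (p ^ 2 + q) +
          (Metric.closedBall τ δ).indicator (fun _ => ENNReal.ofReal p) τ' := by
      intro τ hτ τ' hτ'
      have hBi : Prod.mk (τ, τ') ⁻¹' B = Prod.mk τ ⁻¹' A ∩ Prod.mk τ' ⁻¹' A := rfl
      rw [hBi]
      by_cases hd : |τ - τ'| ≤ δ
      · have : τ' ∈ Metric.closedBall τ δ := by
          rw [Metric.mem_closedBall, dist_comm, Real.dist_eq]; exact hd
        rw [Set.indicator_of_mem this, ← hsec τ hτ]
        exact (measure_mono Set.inter_subset_left).trans le_add_self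
      · refine le_trans ?_ le_self_add
        rw [← ENNReal.ofReal_toReal (measure_ne_top P (Prod.mk τ ⁻¹' A ∩ Prod.mk τ' ⁻¹' A))]
        exact ENNReal.ofReal_le_ofReal (h2 τ hτ τ' hτ' (not_le.1 hd))
    have hin : ∀ τ ∈ Set.Icc u v, ∫⁻ τ', P (Prod.mk (τ, τ') ⁻¹' B) ∂μ ≤
        ENNReal.ofReal ((p ^ 2 + q) * L + p * (2 * δ)) := by
      intro τ hτ
      calc ∫⁻ τ', P (Prod.mk (τ, τ') ⁻¹' B) ∂μ
          ≤ ∫⁻ τ', (ENNReal.ofReal (p ^ 2 + q) +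
          (Metric.closedBall τ δ).indicator (fun _ => ENNReal.ofReal p) τ') ∂μ :=
            setLIntegral_mono' measurableSet_Icc (hb τ hτ)
        _ = ENNReal.ofReal (p ^ 2 + q) * ENNReal.ofReal L +
              ENNReal.ofReal p * μ (Metric.closedBall τ δ) := by
            rw [lintegral_add_left measurable_const, lintegral_const, hμuniv,
              lintegral_indicator_const Metric.isClosed_closedBall.measurableSet]
        _ ≤ ENNReal.ofReal (p ^ 2 + q) * ENNReal.ofReal L +
              ENNReal.ofReal p * ENNReal.ofReal (2 * δ) := by
            gcongr
            rw [← Real.volume_closedBall τ δ]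
            exact Measure.restrict_apply_le _ _
        _ = _ := by
            rw [← ENNReal.ofReal_mul (by positivity), ← ENNReal.ofReal_mul hp.le,
              ← ENNReal.ofReal_add (by positivity) (by positivity)]
    calc ∫⁻ ω, f ω ^ 2 ∂P = ((μ.prod μ).prod P) B := by
          rw [Measure.prod_apply_symm hBm]; simp only [e]
      _ = ∫⁻ τ, ∫⁻ τ', P (Prod.mk (τ, τ') ⁻¹' B) ∂μ ∂μ := by
          rw [Measure.prod_apply hBm, lintegral_prod _
            (measurable_measure_prodMk_left hBm).aemeasurable]
      _ ≤ ∫⁻ τ, ENNReal.ofReal ((p ^ 2 + q) * L + p * (2 * δ)) ∂μ :=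
          setLIntegral_mono' measurableSet_Icc hin
      _ = _ := by
          rw [lintegral_const, hμuniv, ← ENNReal.ofReal_mul (by positivity)]
          congr 1; ring
  set X : Ω → ℝ := fun ω => (f ω).toReal with hX
  have hXm : Measurable X := hfm.ennreal_toReal
  have hXL : MemLp X 2 P := by
    refine MemLp.of_bound hXm.aestronglyMeasurable L (Filter.Eventually.of_forall fun ω => ?_)
    rw [Real.norm_of_nonneg ENNReal.toReal_nonneg]
    exact ENNReal.toReal_le_of_le_ofReal hLpos.le (hfle ω)
  have hEX : ∫ ω, X ω ∂P = p * L := by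
    rw [integral_toReal hfm.aemeasurable
      (Filter.Eventually.of_forall fun ω => (hftop ω).lt_top), hE1,
      ENNReal.toReal_ofReal (by positivity)]
  have hEX2 : ∫ ω, (X ^ 2) ω ∂P ≤ (p ^ 2 + q) * L ^ 2 + p * (2 * δ) * L := by
    have : ∀ ω, (X ^ 2) ω = (f ω ^ 2).toReal := by
      intro ω; simp [hX]
    simp only [this]
    rw [integral_toReal (hfm.pow_const 2).aemeasurable
      (Filter.Eventually.of_forall fun ω => (ENNReal.pow_ne_top (hftop ω)).lt_top)]
    exact ENNReal.toReal_le_of_le_ofReal (by positivity) hE2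
  have hvar : ProbabilityTheory.variance X P ≤ q * L ^ 2 + p * (2 * δ) * L := by
    rw [ProbabilityTheory.variance_eq_sub hXL, hEX]
    nlinarith [hEX2]
  have hcheb := ProbabilityTheory.meas_ge_le_variance_div_sq hXL (c := p * L) (by positivity)
  have hSet : {ω : Ω | 0 < volume {τ ∈ Set.Icc u v | (τ, ω) ∈ A}} = {ω | 0 < f ω} := by
    simp only [hfv]
  have hSm : MeasurableSet {ω | 0 < f ω} := measurableSet_lt measurable_const hfm
  rw [hSet]
  have hcompl : P {ω | 0 < f ω}ᶜ ≤
      ENNReal.ofReal (ProbabilityTheory.variance X P / (p * L) ^ 2) := by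
    refine le_trans (measure_mono ?_) hcheb
    intro ω hω
    have h0 : f ω = 0 := by simpa using hω
    have hX0 : X ω = 0 := by simp [hX, h0]
    simp only [Set.mem_setOf_eq, hX0, hEX, zero_sub, abs_neg]
    exact le_abs_self _
  have hcr : P.real {ω | 0 < f ω}ᶜ ≤ ProbabilityTheory.variance X P / (p * L) ^ 2 :=
    ENNReal.toReal_le_of_le_ofReal
      (div_nonneg (ProbabilityTheory.variance_nonneg _ _) (by positivity)) hcompl
  rw [probReal_compl_eq_one_sub hSm] at hcr
  have hfin : ProbabilityTheory.variance X P / (p * L) ^ 2 ≤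
      2 * δ / (L * p) + q / p ^ 2 := by
    calc _ ≤ (q * L ^ 2 + p * (2 * δ) * L) / (p * L) ^ 2 := by gcongr
      _ = _ := by field_simp; ring
  change _ ≤ P.real {ω | 0 < f ω}
  linarith

/-- **Abstract form of Proposition 7** (including the strengthening
`P(Ê_k ∩ [u,v] ≠ ∅) → 1` noted at the end of Section 5).  Let `(Ω, ℱ, P)` be a
probability space, `γ > 1`, `a > 0`, `c > 0`, and for each `k ≥ 1` let
`A_k ⊆ [0,1] × Ω` be jointly measurable with sections `A_k^τ` satisfying
(i) `P(A_k^τ) = p_k` for all `τ ∈ [0,1]`;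
(ii) `P(A_k^τ ∩ A_k^{τ'}) ≤ p_k² + c (γ^k |τ − τ'|)^{−a}` for `τ ≠ τ'` in `[0,1]`;
(iii) `p_k γ^{k/2} → ∞` and `p_k² γ^{ka/2} → ∞`.
Then for all `0 ≤ u < v ≤ 1`, the probability that
`{τ ∈ [u,v] : (τ,ω) ∈ A_k}` has positive Lebesgue measure tends to `1` as `k → ∞`. -/
theorem stmt_16 {Ω : Type*} [MeasurableSpace Ω] (P : Measure Ω) [IsProbabilityMeasure P]
    (γ a c : ℝ) (hγ : 1 < γ) (ha : 0 < a) (hc : 0 < c)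
    (A : ℕ → Set (ℝ × Ω)) (hA : ∀ k : ℕ, 1 ≤ k → MeasurableSet (A k))
    (p : ℕ → ℝ) (hp : ∀ k : ℕ, 1 ≤ k → 0 < p k ∧ p k ≤ 1)
    (hstat : ∀ k : ℕ, 1 ≤ k → ∀ τ ∈ Set.Icc (0:ℝ) 1,
      (P (Prod.mk τ ⁻¹' A k)).toReal = p k)
    (hdec : ∀ k : ℕ, 1 ≤ k → ∀ τ ∈ Set.Icc (0:ℝ) 1, ∀ τ' ∈ Set.Icc (0:ℝ) 1, τ ≠ τ' →
      (P (Prod.mk τ ⁻¹' A k ∩ Prod.mk τ' ⁻¹' A k)).toReal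
        ≤ (p k) ^ 2 + c * (γ ^ k * |τ - τ'|) ^ (-a))
    (hlim₁ : Filter.Tendsto (fun k : ℕ => p k * γ ^ ((k : ℝ) / 2))
      Filter.atTop Filter.atTop)
    (hlim₂ : Filter.Tendsto (fun k : ℕ => (p k) ^ 2 * γ ^ ((k : ℝ) * a / 2))
      Filter.atTop Filter.atTop) :
    ∀ u v : ℝ, 0 ≤ u → u < v → v ≤ 1 →
      Filter.Tendsto
        (fun k : ℕ => (P {ω : Ω | 0 < volume {τ ∈ Set.Icc u v | (τ, ω) ∈ A k}}).toReal)
        Filter.atTop (nhds 1) := by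
  intro u v hu huv hv
  have hsub : ∀ τ ∈ Set.Icc u v, τ ∈ Set.Icc (0:ℝ) 1 := fun τ h => ⟨hu.trans h.1, h.2.trans hv⟩
  have hγ0 : 0 < γ := by linarith
  have hlow : Filter.Tendsto (fun k : ℕ => 1 - (2 / (v - u) * (p k * γ ^ ((k : ℝ) / 2))⁻¹
      + c * ((p k) ^ 2 * γ ^ ((k : ℝ) * a / 2))⁻¹)) Filter.atTop (nhds 1) := by
    have h := ((hlim₁.inv_tendsto_atTop.const_mul (2 / (v - u))).add
      (hlim₂.inv_tendsto_atTop.const_mul c)).const_sub 1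
    simpa using h
  refine tendsto_of_tendsto_of_tendsto_of_le_of_le' hlow tendsto_const_nhds ?_
    (Filter.Eventually.of_forall fun k => measureReal_le_one)
  filter_upwards [Filter.eventually_ge_atTop 1] with k hk
  have hD : 0 < γ ^ ((k : ℝ) / 2) := Real.rpow_pos_of_pos hγ0 _
  have hDa : 0 < γ ^ ((k : ℝ) * a / 2) := Real.rpow_pos_of_pos hγ0 _
  have hpk := (hp k hk).1
  have hLpos : 0 < v - u := sub_pos.2 huv
  have key := second_moment_aux P (A k) (hA k hk) (p k) (c * (γ ^ ((k : ℝ) * a / 2))⁻¹)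
    ((γ ^ ((k : ℝ) / 2))⁻¹) u v hpk (by positivity) (by positivity) huv
    (fun τ hτ => hstat k hk τ (hsub τ hτ)) ?_
  · refine le_trans (le_of_eq ?_) key
    field_simp
  · intro τ hτ τ' hτ' hd
    have hpos : 0 < |τ - τ'| := lt_trans (by positivity) hd
    have hne : τ ≠ τ' := by
      rintro rfl
      simp at hpos
    refine (hdec k hk τ (hsub τ hτ) τ' (hsub τ' hτ') hne).trans ?_
    gcongr
    have hsq : γ ^ k = γ ^ ((k : ℝ) / 2) * γ ^ ((k : ℝ) / 2) := by
      rw [← Real.rpow_add hγ0, add_halves, Real.rpow_natCast]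
    have hge : γ ^ ((k : ℝ) / 2) ≤ γ ^ k * |τ - τ'| := by
      calc γ ^ ((k : ℝ) / 2) = γ ^ k * (γ ^ ((k : ℝ) / 2))⁻¹ := by
            rw [hsq]; field_simp
        _ ≤ _ := by gcongr
    calc (γ ^ k * |τ - τ'|) ^ (-a) ≤ (γ ^ ((k : ℝ) / 2)) ^ (-a) :=
          Real.rpow_le_rpow_of_nonpos hD hge (by linarith)
      _ = (γ ^ ((k : ℝ) * a / 2))⁻¹ := by
          rw [← Real.rpow_mul hγ0.le, ← Real.rpow_neg hγ0.le]
          congr 1; ring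
end
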